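/- arXiv:2502.12519 — 2 statements merged into one kernel-verified Lean document; each statement's English description precedes it below -/
import Mathlib

section
/- Let φ ≥ 0 and η ∈ [0,1) be real numbers, and let 𝒞* be a clustering with obj(𝒞*) ≤ φ. Let u and v be vertices with deg(u) > (3+η)φ and deg(v) > (3+η)φ lying in different clusters of 𝒞* (𝒞*_u ≠ 𝒞*_v), and let w be a vertex with deg(w) ≤ (3+η)φ. If w ∈ 𝒞*_u, then |N[v] Δ N[w]| > (1+η)·2φ. -/
open Finset

/-- Closed neighborhood of a vertex (the vertex together with its neighbors), as a finset. -/
def closedNbr {V : Type*} [Fintype V] [DecidableEq V]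
    (G : SimpleGraph V) [DecidableRel G.Adj] (v : V) : Finset V :=
  insert v (G.neighborFinset v)

/-- Objective of a clustering `C` (given as the map sending each vertex to its cluster):
the maximum disagreement `|N[v] Δ C v|` over all vertices `v`. -/
def clObj {V : Type*} [Fintype V] [DecidableEq V]
    (G : SimpleGraph V) [DecidableRel G.Adj] (C : V → Finset V) : ℕ :=
  Finset.univ.sup fun v => (symmDiff (closedNbr G v) (C v)).card

theorem card_closedNbr {V : Type*} [Fintype V] [DecidableEq V]
    (G : SimpleGraph V) [DecidableRel G.Adj] (v : V) :
    (closedNbr G v).card = G.degree v + 1 := by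
  simp [closedNbr]

theorem card_le_card_add_card_symmDiff {α : Type*} [DecidableEq α] (A B : Finset α) :
    A.card ≤ B.card + (symmDiff A B).card :=
  (Finset.card_le_card fun x hx => by
    by_cases hB : x ∈ B <;> simp [Finset.mem_symmDiff, hx, hB]).trans
    (Finset.card_union_le B (symmDiff A B))

theorem card_symmDiff_triangle {α : Type*} [DecidableEq α] (A B C : Finset α) :
    (symmDiff A C).card ≤ (symmDiff A B).card + (symmDiff B C).card :=
  (Finset.card_le_card (symmDiff_triangle A B C)).trans (Finset.card_union_le _ _)

/-- Every vertex's disagreement is at most the objective. -/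
theorem card_symmDiff_le_clObj {V : Type*} [Fintype V] [DecidableEq V]
    (G : SimpleGraph V) [DecidableRel G.Adj] (C : V → Finset V) (v : V) :
    (symmDiff (closedNbr G v) (C v)).card ≤ clObj G C :=
  Finset.le_sup (f := fun v => (symmDiff (closedNbr G v) (C v)).card) (Finset.mem_univ v)

/-- No stealing on low-degree nodes: if high-degree $u,v$ lie in different optimal
clusters and the low-degree vertex $w$ lies in $u$'s cluster, then
$|N[v] Δ N[w]| > (1+η)·2φ$. -/
theorem no_stealing
    {V : Type*} [Fintype V] [DecidableEq V]
    (G : SimpleGraph V) [DecidableRel G.Adj]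
    (φ η : ℝ) (hφ : 0 ≤ φ) (hη0 : 0 ≤ η) (hη1 : η < 1)
    (Cs : V → Finset V)
    (hCmem : ∀ z, z ∈ Cs z)
    (hCpart : ∀ z w, z ∈ Cs w → Cs z = Cs w)
    (hobj : (clObj G Cs : ℝ) ≤ φ)
    (u v w : V)
    (hu : (3 + η) * φ < (G.degree u : ℝ))
    (hv : (3 + η) * φ < (G.degree v : ℝ))
    (huv : Cs u ≠ Cs v)
    (hw : (G.degree w : ℝ) ≤ (3 + η) * φ)
    (hwu : w ∈ Cs u) :
    (1 + η) * (2 * φ) < ((symmDiff (closedNbr G v) (closedNbr G w)).card : ℝ) := by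
  have hwC : Cs w = Cs u := hCpart w u hwu
  have hdisj : Disjoint (Cs v) (Cs w) := by
    rw [hwC, Finset.disjoint_left]
    intro x hxv hxu
    exact huv ((hCpart x u hxu).symm.trans (hCpart x v hxv))
  have hsplit : (symmDiff (Cs v) (Cs w)).card = (Cs v).card + (Cs u).card := by
    rw [hdisj.symmDiff_eq_sup, Finset.sup_eq_union, Finset.card_union_of_disjoint hdisj, hwC]
  have hle (z : V) : ((symmDiff (closedNbr G z) (Cs z)).card : ℝ) ≤ φ :=
    (Nat.cast_le.mpr (card_symmDiff_le_clObj G Cs z)).trans hobj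
  have hcluster (z : V) : (G.degree z : ℝ) + 1 ≤ (Cs z).card + φ := by
    have h := card_le_card_add_card_symmDiff (closedNbr G z) (Cs z)
    rw [card_closedNbr] at h
    have h' : (G.degree z : ℝ) + 1 ≤
        (Cs z).card + (symmDiff (closedNbr G z) (Cs z)).card := by exact_mod_cast h
    linarith [hle z]
  have htri : ((Cs v).card : ℝ) + (Cs u).card ≤
      (symmDiff (closedNbr G v) (Cs v)).card +
        ((symmDiff (closedNbr G v) (closedNbr G w)).card +
          (symmDiff (closedNbr G w) (Cs w)).card) := by
    have h₁ := card_symmDiff_triangle (Cs v) (closedNbr G v) (Cs w)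
    have h₂ := card_symmDiff_triangle (closedNbr G v) (closedNbr G w) (Cs w)
    rw [symmDiff_comm (Cs v) (closedNbr G v)] at h₁
    exact_mod_cast (by omega : (Cs v).card + (Cs u).card ≤ _)
  linarith [hcluster u, hcluster v, hle v, hle w]
end

section
/- Let φ ≥ 0 and η ∈ [0,1) be real numbers. Let u, v, w be vertices with deg(u) > (3+η)φ and deg(v) > (3+η)φ, and suppose |N[v] ∩ N[u] ∩ N[w]| = φ + t for some real t > 0. Then |N[v] Δ N[w]| + |N[u] Δ N[w]| > (4+2η)φ − 2t. -/
open Finset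

/-- The size of `A` outside `A ∩ B ∩ W` splits into a part outside `W` and a part of `W`
outside `B`. -/
theorem card_le_card_sdiff_add_card_sdiff_add_card_inter {α : Type*} [DecidableEq α]
    (A B W : Finset α) :
    A.card ≤ (A \ W).card + (W \ B).card + (A ∩ B ∩ W).card := by
  have hsub : A ⊆ (A \ W ∪ W \ B) ∪ (A ∩ B ∩ W) := by
    intro x hx
    simp only [mem_union, mem_sdiff, mem_inter]
    tauto
  exact (card_le_card hsub).trans
    ((card_union_le _ _).trans (Nat.add_le_add_right (card_union_le _ _) _))

theorem card_symmDiff_eq_card_sdiff_add_card_sdiff {α : Type*} [DecidableEq α]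
    (A B : Finset α) : (symmDiff A B).card = (A \ B).card + (B \ A).card :=
  card_union_of_disjoint disjoint_sdiff_sdiff

theorem card_add_card_le_card_symmDiff_add {α : Type*} [DecidableEq α] (A B W : Finset α) :
    A.card + B.card ≤
      (symmDiff A W).card + (symmDiff B W).card + 2 * (A ∩ B ∩ W).card := by
  have hA := card_le_card_sdiff_add_card_sdiff_add_card_inter A B W
  have hB := card_le_card_sdiff_add_card_sdiff_add_card_inter B A W
  rw [inter_comm B A] at hB
  rw [card_symmDiff_eq_card_sdiff_add_card_sdiff, card_symmDiff_eq_card_sdiff_add_card_sdiff]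
  omega

theorem degree_le_card_closedNbr {V : Type*} [Fintype V] [DecidableEq V]
    (G : SimpleGraph V) [DecidableRel G.Adj] (v : V) :
    G.degree v ≤ (closedNbr G v).card :=
  card_le_card (subset_insert v (G.neighborFinset v))

/-- If $deg(u), deg(v) > (3+η)φ$ and $|N[v] ∩ N[u] ∩ N[w]| = φ + t$ for some $t > 0$,
then $|N[v] Δ N[w]| + |N[u] Δ N[w]| > (4+2η)φ − 2t$. -/
theorem symmDiff_sum_lower_bound_hard
    {V : Type*} [Fintype V] [DecidableEq V]
    (G : SimpleGraph V) [DecidableRel G.Adj]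
    (φ η : ℝ) (hφ : 0 ≤ φ) (hη0 : 0 ≤ η) (hη1 : η < 1)
    (u v w : V)
    (hu : (3 + η) * φ < (G.degree u : ℝ))
    (hv : (3 + η) * φ < (G.degree v : ℝ))
    (t : ℝ) (ht : 0 < t)
    (hint : ((closedNbr G v ∩ closedNbr G u ∩ closedNbr G w).card : ℝ) = φ + t) :
    (4 + 2 * η) * φ - 2 * t <
      ((symmDiff (closedNbr G v) (closedNbr G w)).card : ℝ) +
        ((symmDiff (closedNbr G u) (closedNbr G w)).card : ℝ) := by
  have hdu : (G.degree u : ℝ) ≤ (closedNbr G u).card :=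
    mod_cast degree_le_card_closedNbr G u
  have hdv : (G.degree v : ℝ) ≤ (closedNbr G v).card :=
    mod_cast degree_le_card_closedNbr G v
  have hcard : ((closedNbr G v).card : ℝ) + (closedNbr G u).card ≤
      (symmDiff (closedNbr G v) (closedNbr G w)).card +
        (symmDiff (closedNbr G u) (closedNbr G w)).card +
          2 * (closedNbr G v ∩ closedNbr G u ∩ closedNbr G w).card :=
    mod_cast card_add_card_le_card_symmDiff_add (closedNbr G v) (closedNbr G u) (closedNbr G w)
  rw [hint] at hcard
  linarith
end
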